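/- Suppose v ∈ Σ has the form v = ℓ·v(w) for some real ℓ > 0 and some finite word w over {0,1,2,3}. Define v₀ = v and, for i ≥ 0, v_{i+1} = σ_{kᵢ}⁻¹vᵢ, where kᵢ is the unique index with vᵢ ∈ Σ_{kᵢ} (well defined since the sectors Σ₀, Σ₁, Σ₂, Σ₃ partition Σ and each σᵢ⁻¹ maps Σᵢ into Σ). Then there exists N such that kᵢ = 0 for all i ≥ N, v_N = (ℓ', 0)ᵀ for some real ℓ' > 0, and vᵢ = v_N for all i ≥ N. -/

import Mathlib

noncomputable section
open Matrix

noncomputable def φ : ℝ := (1 + Real.sqrt 5) / 2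

noncomputable def σ : Fin 4 → Matrix (Fin 2) (Fin 2) ℝ
  | 0 => !![1, φ; 0, 1]
  | 1 => !![φ, φ; 1, φ]
  | 2 => !![φ, 1; φ, φ]
  | 3 => !![1, 0; φ, 1]

abbrev Word := List (Fin 4)

noncomputable def vword (w : Word) : Fin 2 → ℝ := ((w.map σ).prod).mulVec ![1, 0]

def Cone : Set (Fin 2 → ℝ) := {p | 0 < p 0 ∧ 0 ≤ p 1}

def Sector (i : Fin 4) : Set (Fin 2 → ℝ) := (fun p => (σ i).mulVec p) '' Cone

theorem phi_sq : φ * φ = φ + 1 := by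
  have h := Real.mul_self_sqrt (show (0:ℝ) ≤ 5 by norm_num)
  unfold φ
  nlinarith

theorem phi_gt : 1 < φ := by
  have h : 1 < Real.sqrt 5 := by
    rw [Real.lt_sqrt] <;> norm_num
  unfold φ
  linarith

theorem s0 (p : Fin 2 → ℝ) : (σ 0).mulVec p = ![p 0 + φ * p 1, p 1] := by
  ext i; fin_cases i <;> simp [σ, Matrix.mulVec, dotProduct, Fin.sum_univ_two]
theorem s1 (p : Fin 2 → ℝ) : (σ 1).mulVec p = ![φ * p 0 + φ * p 1, p 0 + φ * p 1] := by
  ext i; fin_cases i <;> simp [σ, Matrix.mulVec, dotProduct, Fin.sum_univ_two]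
theorem s2 (p : Fin 2 → ℝ) : (σ 2).mulVec p = ![φ * p 0 + p 1, φ * p 0 + φ * p 1] := by
  ext i; fin_cases i <;> simp [σ, Matrix.mulVec, dotProduct, Fin.sum_univ_two]
theorem s3 (p : Fin 2 → ℝ) : (σ 3).mulVec p = ![p 0, φ * p 0 + p 1] := by
  ext i; fin_cases i <;> simp [σ, Matrix.mulVec, dotProduct, Fin.sum_univ_two]

theorem det_s (i : Fin 4) : (σ i).det = 1 := by
  have h := phi_sq
  fin_cases i <;> simp [σ, Matrix.det_fin_two] <;> linarith

theorem inv_s (i : Fin 4) (p : Fin 2 → ℝ) : (σ i)⁻¹.mulVec ((σ i).mulVec p) = p := by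
  rw [Matrix.mulVec_mulVec, Matrix.nonsing_inv_mul _ (by rw [det_s]; exact isUnit_one),
    Matrix.one_mulVec]

theorem cone_s (i : Fin 4) (p : Fin 2 → ℝ) (hp : p ∈ Cone) : (σ i).mulVec p ∈ Cone := by
  obtain ⟨h0, h1⟩ := hp
  have h := phi_gt
  have hφ : 0 < φ := by linarith
  fin_cases i
  · show (σ 0).mulVec p ∈ Cone
    rw [s0]; constructor <;> simp <;> positivity
  · show (σ 1).mulVec p ∈ Cone
    rw [s1]; constructor <;> simp <;> positivity
  · show (σ 2).mulVec p ∈ Cone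
    rw [s2]; constructor <;> simp <;> positivity
  · show (σ 3).mulVec p ∈ Cone
    rw [s3]; constructor <;> simp <;> positivity

def chr (i : Fin 4) (x y : ℝ) : Prop :=
  match i with
  | 0 => φ * y < x
  | 1 => x ≤ φ * y ∧ y < x
  | 2 => x ≤ y ∧ y < φ * x
  | 3 => φ * x ≤ y

theorem sector_chr (i : Fin 4) (v : Fin 2 → ℝ) (hv : v ∈ Sector i) : chr i (v 0) (v 1) := by
  obtain ⟨p, ⟨h0, h1⟩, rfl⟩ := hv
  have h := phi_gt
  have hs := phi_sq
  have e0 : φ * (φ * p 0) = φ * p 0 + p 0 := by rw [← mul_assoc, hs]; ring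
  have e1 : φ * (φ * p 1) = φ * p 1 + p 1 := by rw [← mul_assoc, hs]; ring
  have g0 : p 0 < φ * p 0 := by nlinarith
  have g1 : p 1 ≤ φ * p 1 := by nlinarith
  fin_cases i
  · show chr 0 ((σ 0).mulVec p 0) ((σ 0).mulVec p 1)
    rw [s0]; simp [chr]; linarith
  · show chr 1 ((σ 1).mulVec p 0) ((σ 1).mulVec p 1)
    rw [s1]; simp [chr, mul_add]; constructor <;> linarith
  · show chr 2 ((σ 2).mulVec p 0) ((σ 2).mulVec p 1)
    rw [s2]; simp [chr, mul_add]; constructor <;> linarith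
  · show chr 3 ((σ 3).mulVec p 0) ((σ 3).mulVec p 1)
    rw [s3]; simp [chr]; linarith

theorem sector_unique (i j : Fin 4) (v : Fin 2 → ℝ) (hi : v ∈ Sector i) (hj : v ∈ Sector j) :
    i = j := by
  have hc : v ∈ Cone := by
    obtain ⟨p, hp, rfl⟩ := hi
    exact cone_s i p hp
  obtain ⟨h0, h1⟩ := hc
  have h := phi_gt
  have g0 : v 0 < φ * v 0 := by nlinarith
  have g1 : v 1 ≤ φ * v 1 := by nlinarith
  have a := sector_chr i v hi
  have b := sector_chr j v hj
  clear hi hj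
  fin_cases i <;> fin_cases j <;> simp [chr] at a b ⊢ <;> grind

theorem vword_cons (a : Fin 4) (w : Word) : vword (a :: w) = (σ a).mulVec (vword w) := by
  simp only [vword, Matrix.mulVec_mulVec, List.map_cons, List.prod_cons]

theorem vword_cone (w : Word) : vword w ∈ Cone := by
  induction w with
  | nil => simp [vword, Cone]
  | cons a w ih => rw [vword_cons]; exact cone_s a _ ih

theorem smul_cone (ℓ : ℝ) (hℓ : 0 < ℓ) (p : Fin 2 → ℝ) (hp : p ∈ Cone) : ℓ • p ∈ Cone := by
  obtain ⟨h0, h1⟩ := hp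
  constructor <;> simp <;> positivity

theorem step_known (a : Fin 4) (p u u' : Fin 2 → ℝ) (k : Fin 4) (hp : p ∈ Cone)
    (hu : u = (σ a).mulVec p) (hk : u ∈ Sector k) (h' : u' = (σ k)⁻¹.mulVec u) :
    k = a ∧ u' = p := by
  have hka : k = a := sector_unique k a u hk ⟨p, hp, hu.symm⟩
  subst hka
  exact ⟨rfl, by rw [h', hu, inv_s]⟩

theorem main_aux (ℓ : ℝ) (hℓ : 0 < ℓ) (w : Word) :
    ∀ (vseq : ℕ → Fin 2 → ℝ) (kseq : ℕ → Fin 4)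
    (_ : vseq 0 = ℓ • vword w)
    (_ : ∀ i, vseq i ∈ Sector (kseq i))
    (_ : ∀ i, vseq (i + 1) = (σ (kseq i))⁻¹.mulVec (vseq i)),
    ∃ N : ℕ, (∀ i, N ≤ i → kseq i = 0) ∧
      (∃ ℓ' : ℝ, 0 < ℓ' ∧ vseq N = ![ℓ', 0]) ∧
      (∀ i, N ≤ i → vseq i = vseq N) := by
  induction w with
  | nil =>
    intro vseq kseq h0 hmem hstep
    have h0' : vseq 0 = ![ℓ, 0] := by rw [h0]; simp [vword]
    have hc : (![ℓ, 0] : Fin 2 → ℝ) ∈ Cone := by simp [Cone, hℓ]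
    have key : (![ℓ, 0] : Fin 2 → ℝ) = (σ 0).mulVec ![ℓ, 0] := by rw [s0]; simp
    have hall : ∀ i, vseq i = ![ℓ, 0] := by
      intro i
      induction i with
      | zero => exact h0'
      | succ n ih => exact (step_known 0 _ _ _ _ hc (ih.trans key) (hmem n) (hstep n)).2
    exact ⟨0, fun i _ => (step_known 0 _ _ _ _ hc ((hall i).trans key) (hmem i) (hstep i)).1,
      ⟨ℓ, hℓ, h0'⟩, fun i _ => by rw [hall, hall]⟩
  | cons a w ih =>
    intro vseq kseq h0 hmem hstep
    have h1 := (step_known a (ℓ • vword w) _ _ _ (smul_cone ℓ hℓ _ (vword_cone w))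
      (by rw [h0, vword_cons, Matrix.mulVec_smul]) (hmem 0) (hstep 0)).2
    obtain ⟨N, hk, hl, hc⟩ := ih (fun i => vseq (i + 1)) (fun i => kseq (i + 1)) h1
      (fun i => hmem (i + 1)) (fun i => hstep (i + 1))
    refine ⟨N + 1, ?_, hl, ?_⟩
    · intro i hi
      obtain ⟨j, rfl⟩ : ∃ j, i = j + 1 := ⟨i - 1, by omega⟩
      exact hk j (by omega)
    · intro i hi
      obtain ⟨j, rfl⟩ : ∃ j, i = j + 1 := ⟨i - 1, by omega⟩
      exact hc j (by omega)

theorem stmt8 (v : Fin 2 → ℝ) (hv : v ∈ Cone) (ℓ : ℝ) (hℓ : 0 < ℓ) (w : Word)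
    (hvw : v = ℓ • vword w)
    (vseq : ℕ → Fin 2 → ℝ) (kseq : ℕ → Fin 4)
    (h0 : vseq 0 = v)
    (hmem : ∀ i, vseq i ∈ Sector (kseq i))
    (hstep : ∀ i, vseq (i + 1) = (σ (kseq i))⁻¹.mulVec (vseq i)) :
    ∃ N : ℕ, (∀ i, N ≤ i → kseq i = 0) ∧
      (∃ ℓ' : ℝ, 0 < ℓ' ∧ vseq N = ![ℓ', 0]) ∧
      (∀ i, N ≤ i → vseq i = vseq N) := by
  exact main_aux ℓ hℓ w vseq kseq (h0.trans hvw) hmem hstep
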